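/- arXiv:2207.13256 — 6 statements merged into one kernel-verified Lean document; each statement's English description precedes it below -/
import Mathlib

section
/- Consider a discrete-time leader–follower pair with time step δ > 0 in which the leader applies a constant control u(t) = a with a ≤ 0, so that v(t+1) = v(t) + δa; the follower runs a CACC law v̂(t+1) = A·v̂(t) + B·v(t+1) with constants 0 < A ≤ 1/3 and B = 1 − A (so B ≥ 2/3 > 1/2); and the inter-vehicle spacing evolves as s(t+1) = s(t) + A·δ·(v(t) − v̂(t)) + (1/2 − B)·δ²·a. If the initial conditions satisfy s(0) ≥ 0 and v(0) − v̂(0) ≥ a·δ·(B − 1/2)/A, then for every t ≥ 0 one has v(t) − v̂(t) ≥ a·δ·(B − 1/2)/A and s(t) ≥ 0 (indeed s(t) is nondecreasing in t). -/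
/-- Inductive core of the recursive-feasibility argument (Theorem 1, Scenario II):
leader with constant control `a ≤ 0`, CACC follower with gains `0 < A ≤ 1/3`,
`B = 1 - A`; the relative-speed bound and spacing nonnegativity are invariant,
and the spacing is nondecreasing. -/
theorem stmt_0 (δ a A B : ℝ) (hδ : 0 < δ) (ha : a ≤ 0)
    (hA : 0 < A) (hA' : A ≤ 1/3) (hB : B = 1 - A)
    (v vhat s : ℕ → ℝ)
    (hv : ∀ t, v (t + 1) = v t + δ * a)
    (hvhat : ∀ t, vhat (t + 1) = A * vhat t + B * v (t + 1))
    (hs : ∀ t, s (t + 1) = s t + A * δ * (v t - vhat t) + (1/2 - B) * δ^2 * a)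
    (hs0 : 0 ≤ s 0)
    (hinit : v 0 - vhat 0 ≥ a * δ * (B - 1/2) / A) :
    (∀ t, v t - vhat t ≥ a * δ * (B - 1/2) / A ∧ 0 ≤ s t) ∧ Monotone s := by
  subst hB
  have hgap : ∀ t, a * δ * (1 - A - 1/2) ≤ (v t - vhat t) * A := by
    intro t
    induction t with
    | zero => exact (div_le_iff₀ hA).mp hinit
    | succ t ih =>
      have hrec : v (t + 1) - vhat (t + 1) = A * (v t - vhat t + δ * a) := by
        rw [hvhat, hv]
        ring
      rw [hrec]
      have hscaled := mul_le_mul_of_nonneg_left ih hA.le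
      have hslack : 0 ≤ (-a * δ) * (1/2 - 3/2 * A) :=
        mul_nonneg (mul_nonneg (by linarith) hδ.le) (by linarith)
      nlinarith
  have hmono : Monotone s := by
    refine monotone_nat_of_le_succ fun t => ?_
    have hscaled := mul_le_mul_of_nonneg_left (hgap t) hδ.le
    rw [hs]
    linarith
  exact ⟨fun t => ⟨(div_le_iff₀ hA).mpr (hgap t), hs0.trans (hmono t.zero_le)⟩, hmono⟩
end

section
/- Let δ > 0, let A ∈ (0,1) and B = 1 − A with B > 1/2, and let ã ≤ 0. Suppose real numbers v, v̂ satisfy v − v̂ ≥ ã·δ·(B − 1/2)/A, and let a control u satisfy u ≥ B·(B − 1/2)·ã/A². Define the updated speeds v' = v + δu and v̂' = A·v̂ + B·v'. Then v' − v̂' ≥ ã·δ·(B − 1/2)/A; that is, the relative-speed lower bound v − v̂ ≥ ãδ(B − 1/2)/A is invariant under one step of the dynamics. -/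
/-- One-step invariance of Condition (iv) of Theorem 1 (equation (55.2)):
the relative-speed lower bound `v - v̂ ≥ ãδ(B - 1/2)/A` is preserved by one
step of the leader double-integrator / CACC-follower dynamics. -/
theorem stmt_1 (δ A B atil v vhat u : ℝ) (hδ : 0 < δ)
    (hA : 0 < A) (hA1 : A < 1) (hB : B = 1 - A) (hBhalf : 1/2 < B)
    (hatil : atil ≤ 0)
    (hrel : v - vhat ≥ atil * δ * (B - 1/2) / A)
    (hu : u ≥ B * (B - 1/2) * atil / A^2) :
    (v + δ * u) - (A * vhat + B * (v + δ * u)) ≥ atil * δ * (B - 1/2) / A := by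
  subst hB
  calc (v + δ * u) - (A * vhat + (1 - A) * (v + δ * u))
      = A * ((v - vhat) + δ * u) := by ring
    _ ≥ A * (atil * δ * (1 - A - 1/2) / A + δ * ((1 - A) * (1 - A - 1/2) * atil / A^2)) := by
      gcongr
    _ = atil * δ * (1 - A - 1/2) / A := by
      field_simp
      ring
end

section
/- Let δ > 0, A ∈ (0,1), B = 1 − A with B > 1/2, and let ã ≤ 0. Suppose s ≥ 0 and v − v̂ ≥ ã·δ·(B − 1/2)/A. Then for any control u with u ≤ ã (in particular for u = ã), the updated spacing s' = s + A·δ·(v − v̂) + (1/2 − B)·δ²·u satisfies s' ≥ s ≥ 0. -/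
/-- Spacing-nonnegativity step in the proof of Theorem 1, Scenario II:
under Condition (iv) and for any control `u ≤ ã`, the updated spacing
is at least the current (nonnegative) spacing. -/
theorem stmt_3 (δ A B atil s v vhat : ℝ) (hδ : 0 < δ)
    (hA : 0 < A) (hA1 : A < 1) (hB : B = 1 - A) (hBhalf : 1/2 < B)
    (hatil : atil ≤ 0) (hs : 0 ≤ s)
    (hrel : v - vhat ≥ atil * δ * (B - 1/2) / A) :
    ∀ u, u ≤ atil →
      s ≤ s + A * δ * (v - vhat) + (1/2 - B) * δ^2 * u ∧
      0 ≤ s + A * δ * (v - vhat) + (1/2 - B) * δ^2 * u := by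
  intro u hu
  have hspeed : atil * δ * (B - 1/2) ≤ (v - vhat) * A := (div_le_iff₀ hA).mp hrel
  have hgain : δ * (atil * δ * (B - 1/2)) ≤ δ * ((v - vhat) * A) :=
    mul_le_mul_of_nonneg_left hspeed hδ.le
  have hcontrol : 0 ≤ (B - 1/2) * δ^2 * (atil - u) :=
    mul_nonneg (mul_nonneg (by linarith) (sq_nonneg δ)) (by linarith)
  have hstep : s ≤ s + A * δ * (v - vhat) + (1/2 - B) * δ^2 * u := by
    linarith
  exact ⟨hstep, hs.trans hstep⟩
end

section
/- Let τ > 0, d ∈ ℝ, u ∈ ℝ, and consider the leader–Newell-follower system with constant leader acceleration u: v_n = v_0 + nτu, x_n = x_{n−1} + τv_{n−1} + (τ²/2)u, follower initial speed v̂_0 = v_0, v̂_n = (s_{n−1} − d)/τ for n ≥ 1, x̂_n = x̂_{n−1} + τ·v̂_{n−1}, and s_n = x_n − x̂_n with initial spacing s_0. Then the spacings admit the closed forms: s_1 = s_0 + (1/2)uτ², s_2 = v_0τ + 2uτ² + d, s_3 = 2v_0τ − s_0 + 4uτ² + 2d, s_4 = 2v_0τ − s_0 + (11/2)uτ² + 2d,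 s_5 = v_0τ + 6uτ² + d, and s_6 = s_0 + 6uτ². -/
/-- Two-step recurrence for the spacing behind a leader with constant acceleration. -/
theorem spacing_recurrence {τ d u : ℝ} (hτ : τ ≠ 0)
    {v x vhat xhat s : ℕ → ℝ}
    (hv : ∀ n : ℕ, v n = v 0 + n * τ * u)
    (hx : ∀ n, x (n + 1) = x n + τ * v n + τ^2 / 2 * u)
    (hvhat : ∀ n, vhat (n + 1) = (s n - d) / τ)
    (hxhat : ∀ n, xhat (n + 1) = xhat n + τ * vhat n)
    (hs : ∀ n, s n = x n - xhat n) (n : ℕ) :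
    s (n + 2) = s (n + 1) - s n + d + τ * v 0 + (n + 3 / 2) * u * τ^2 := by
  have hfollow : τ * vhat (n + 1) = s n - d := by
    rw [hvhat, mul_div_cancel₀ _ hτ]
  have hlead := hv (n + 1)
  push_cast at hlead
  linear_combination hs (n + 2) - hs (n + 1) + hx (n + 1) - hxhat (n + 1) - hfollow + τ * hlead

/-- Appendix B of the paper: closed-form spacings for a constant-deceleration
double-integrator leader followed by a Newell car-follower. -/
theorem stmt_7 (τ d u : ℝ) (hτ : 0 < τ)
    (v x vhat xhat s : ℕ → ℝ)
    (hv : ∀ n : ℕ, v n = v 0 + n * τ * u)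
    (hx : ∀ n, x (n + 1) = x n + τ * v n + τ^2 / 2 * u)
    (hvhat0 : vhat 0 = v 0)
    (hvhat : ∀ n, vhat (n + 1) = (s n - d) / τ)
    (hxhat : ∀ n, xhat (n + 1) = xhat n + τ * vhat n)
    (hs : ∀ n, s n = x n - xhat n) :
    s 1 = s 0 + (1/2) * u * τ^2 ∧
    s 2 = v 0 * τ + 2 * u * τ^2 + d ∧
    s 3 = 2 * v 0 * τ - s 0 + 4 * u * τ^2 + 2 * d ∧
    s 4 = 2 * v 0 * τ - s 0 + (11/2) * u * τ^2 + 2 * d ∧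
    s 5 = v 0 * τ + 6 * u * τ^2 + d ∧
    s 6 = s 0 + 6 * u * τ^2 := by
  have hrec := spacing_recurrence hτ.ne' hv hx hvhat hxhat hs
  have h1 : s 1 = s 0 + (1/2) * u * τ^2 := by
    linear_combination hs 1 - hs 0 + hx 0 - hxhat 0 - τ * hvhat0
  have h2 := hrec 0
  have h3 := hrec 1
  have h4 := hrec 2
  have h5 := hrec 3
  have h6 := hrec 4
  norm_num at h2 h3 h4 h5 h6
  refine ⟨h1, ?_, ?_, ?_, ?_, ?_⟩ <;> linarith
end

section
/- In the setting of the constant-deceleration leader–Newell-follower system (v_n = v_0 + nτu; x_n = x_{n−1} + τv_{n−1} + (τ²/2)u; v̂_0 = v_0, v̂_n = (s_{n−1} − d)/τ; x̂_n = x̂_{n−1} + τv̂_{n−1}; s_n = x_n − x̂_n), suppose additionally that the initial spacing is at Newell equilibrium, s_0 = v_0·τ + d, and that u ≤ 0. Then s_n = v_0τ + d + c_n·uτ² with (c_0,…,c_6) = (0, 1/2, 2, 4, 11/2, 6, 6); in particular the minimum spacing over n ∈ {0,1,…,6} is attained at n = 5, with s_5 = v_0τ + 6uτ² + d ≤ s_n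 for all n ∈ {0,…,6}. -/
/-- Appendix B (Table 5): with initial Newell equilibrium spacing
`s 0 = v 0 · τ + d` and `u ≤ 0`, the spacings have the closed forms
`s n = v 0 · τ + d + c n · u · τ²` with `c = (0, 1/2, 2, 4, 11/2, 6, 6)`,
and the minimum over `n ∈ {0,…,6}` is attained at `n = 5`. -/
theorem stmt_8 (τ d u : ℝ) (hτ : 0 < τ)
    (v x vhat xhat s : ℕ → ℝ)
    (hv : ∀ n : ℕ, v n = v 0 + n * τ * u)
    (hx : ∀ n, x (n + 1) = x n + τ * v n + τ^2 / 2 * u)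
    (hvhat0 : vhat 0 = v 0)
    (hvhat : ∀ n, vhat (n + 1) = (s n - d) / τ)
    (hxhat : ∀ n, xhat (n + 1) = xhat n + τ * vhat n)
    (hs : ∀ n, s n = x n - xhat n)
    (hs0 : s 0 = v 0 * τ + d) (hu : u ≤ 0) :
    s 0 = v 0 * τ + d + 0 * u * τ^2 ∧
    s 1 = v 0 * τ + d + (1/2) * u * τ^2 ∧
    s 2 = v 0 * τ + d + 2 * u * τ^2 ∧
    s 3 = v 0 * τ + d + 4 * u * τ^2 ∧
    s 4 = v 0 * τ + d + (11/2) * u * τ^2 ∧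
    s 5 = v 0 * τ + d + 6 * u * τ^2 ∧
    s 6 = v 0 * τ + d + 6 * u * τ^2 ∧
    (s 5 = v 0 * τ + 6 * u * τ^2 + d ∧ ∀ n : ℕ, n ≤ 6 → s 5 ≤ s n) := by
  have step (n : ℕ) :
      s (n + 2) = s (n + 1) + τ * (v 0 + (n + 1) * τ * u) - (s n - d) + τ^2 / 2 * u := by
    have hfollow : τ * vhat (n + 1) = s n - d := by
      rw [hvhat, mul_div_cancel₀ _ hτ.ne']
    have hlead := hv (n + 1)
    push_cast at hlead
    rw [← hlead, ← hfollow, hs (n + 2), hs (n + 1), hx (n + 1), hxhat (n + 1)]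
    ring
  have h1 : s 1 = v 0 * τ + d + (1/2) * u * τ^2 := by
    have hx1 := hx 0
    have hxhat1 := hxhat 0
    rw [hvhat0] at hxhat1
    linarith [hs 0, hs 1]
  have h2 := step 0
  have h3 := step 1
  have h4 := step 2
  have h5 := step 3
  have h6 := step 4
  norm_num at h2 h3 h4 h5 h6
  have hneg : u * τ^2 ≤ 0 := mul_nonpos_of_nonpos_of_nonneg hu (sq_nonneg τ)
  refine ⟨by linarith, h1, by linarith, by linarith, by linarith, by linarith, by linarith,
    by linarith, fun n hn => ?_⟩
  interval_cases n <;> linarith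
end

section
/- In the constant-deceleration leader–Newell-follower system (v_n = v_0 + nτu; x_n = x_{n−1} + τv_{n−1} + (τ²/2)u; v̂_0 = v_0, v̂_n = (s_{n−1} − d)/τ; x̂_n = x̂_{n−1} + τv̂_{n−1}; s_n = x_n − x̂_n), suppose s_0 = v_0·τ + d, u ≤ 0, v_0 ≥ v_min > 0, and 6uτ² + v_min·τ + d ≥ 0. Then the spacing remains nonnegative: s_n ≥ 0 for every n ∈ {0,1,…,6}. -/
/-- Safety conclusion of Theorem 1, Scenario I: in the constant-deceleration
leader–Newell-follower system starting at equilibrium spacing, if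
`6uτ² + v_min·τ + d ≥ 0` and `v 0 ≥ v_min > 0`, then the spacing stays
nonnegative for `n ∈ {0,…,6}`. -/
theorem stmt_10 (τ d u vmin : ℝ) (hτ : 0 < τ)
    (v x vhat xhat s : ℕ → ℝ)
    (hv : ∀ n : ℕ, v n = v 0 + n * τ * u)
    (hx : ∀ n, x (n + 1) = x n + τ * v n + τ^2 / 2 * u)
    (hvhat0 : vhat 0 = v 0)
    (hvhat : ∀ n, vhat (n + 1) = (s n - d) / τ)
    (hxhat : ∀ n, xhat (n + 1) = xhat n + τ * vhat n)
    (hs : ∀ n, s n = x n - xhat n)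
    (hs0 : s 0 = v 0 * τ + d) (hu : u ≤ 0)
    (hvmin : 0 < vmin) (hv0 : vmin ≤ v 0)
    (hsafe : 0 ≤ 6 * u * τ^2 + vmin * τ + d) :
    ∀ n : ℕ, n ≤ 6 → 0 ≤ s n := by
  have follower_step : ∀ n, τ * vhat (n + 1) = s n - d := fun n => by
    rw [hvhat]; field_simp
  have spacing_one : s 1 = v 0 * τ + d + 1 / 2 * (u * τ ^ 2) := by
    have h := hx 0
    have h' := hxhat 0
    have h0 := hs 0
    rw [hvhat0] at h'
    rw [hs 1]
    linarith
  have spacing_step : ∀ n : ℕ,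
      s (n + 2) = s (n + 1) - s n + d + v 0 * τ + (n + 3 / 2) * (u * τ ^ 2) := fun n => by
    have h := hx (n + 1)
    have h' := hxhat (n + 1)
    rw [hv] at h
    rw [follower_step] at h'
    push_cast at h
    rw [hs (n + 2), h, h', hs (n + 1)]
    ring
  have h2 := spacing_step 0
  have h3 := spacing_step 1
  have h4 := spacing_step 2
  have h5 := spacing_step 3
  have h6 := spacing_step 4
  norm_num at h2 h3 h4 h5 h6
  have hw : u * τ ^ 2 ≤ 0 := mul_nonpos_of_nonpos_of_nonneg hu (sq_nonneg τ)
  have hvτ : vmin * τ ≤ v 0 * τ := mul_le_mul_of_nonneg_right hv0 hτ.le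
  intro n hn
  interval_cases n <;> linarith
end
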